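/- Let d ≥ 1 and let g : ℝ^d → [0,∞) be smooth and compactly supported with ∫_{ℝ^d} g² = 1. For ε > 0 define the probability measure p_ε on ℤ^d by p_ε(z) := ∫_{εz + [0,ε)^d} g(x)² dx. Then for every γ > 0, lim_{ε↓0} ε^{d(1−γ)} Σ_{z∈ℤ^d} p_ε(z)^γ = ∫_{ℝ^d} g(x)^{2γ} dx. -/

import Mathlib

open MeasureTheory Filter
open scoped ENNReal NNReal Topology

/-- The lattice `ℤ^d`. -/
abbrev Zd (d : ℕ) := Fin d → ℤ

/-- Real power with the convention `0 ^ 0 = 0`. -/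
noncomputable def mpow (x γ : ℝ) : ℝ := if x = 0 then 0 else x ^ γ

/-- `p` is a probability measure on `ℤ^d`, identified with its mass function. -/
def IsProb {d : ℕ} (p : Zd d → ℝ) : Prop := (∀ z, 0 ≤ p z) ∧ HasSum p 1

/-- The discrete Dirichlet form `S(p) = -(Δ√p, √p)`, with values in `[0,∞]`. -/
noncomputable def dirS {d : ℕ} (p : Zd d → ℝ) : ℝ≥0∞ :=
  2⁻¹ * ∑' z : Zd d, ∑' x : Zd d,
    if (∑ i, |x i - z i|) = 1 then
      ENNReal.ofReal ((Real.sqrt (p x) - Real.sqrt (p z)) ^ 2) else 0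

/-- The functional whose infimum is `χ^{DB}_γ(ρ)`. -/
noncomputable def FDB {d : ℕ} (γ ρ : ℝ) (p : Zd d → ℝ) : ℝ≥0∞ :=
  dirS p + ∑' z : Zd d, ENNReal.ofReal (ρ / (1 - γ) * (mpow (p z) γ - p z))

noncomputable def chiDB (d : ℕ) (γ ρ : ℝ) : ℝ≥0∞ :=
  ⨅ p : {p : Zd d → ℝ // IsProb p}, FDB γ ρ p.1

/-- The functional whose infimum is `χ^{DE}(ρ)`. -/
noncomputable def FDE {d : ℕ} (ρ : ℝ) (p : Zd d → ℝ) : ℝ≥0∞ :=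
  dirS p + ∑' z : Zd d, ENNReal.ofReal (-(ρ * (p z * Real.log (p z))))

noncomputable def chiDE (d : ℕ) (ρ : ℝ) : ℝ≥0∞ :=
  ⨅ p : {p : Zd d → ℝ // IsProb p}, FDE ρ p.1

/-- Admissible test functions: smooth, compactly supported, `L²`-normalised. -/
def TestFun (d : ℕ) (g : EuclideanSpace ℝ (Fin d) → ℝ) : Prop :=
  ContDiff ℝ (⊤ : ℕ∞) g ∧ HasCompactSupport g ∧ ∫ x, (g x) ^ 2 = 1

noncomputable def chiAB (d : ℕ) (ρ : ℝ) : ℝ :=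
  sInf {v : ℝ | ∃ g : EuclideanSpace ℝ (Fin d) → ℝ, TestFun d g ∧
    v = ∫ x, ‖fderiv ℝ g x‖ ^ 2 - ρ * ∫ x, (g x) ^ 2 * Real.log ((g x) ^ 2)}

noncomputable def chiB (d : ℕ) (γ ρ : ℝ) : ℝ :=
  sInf {v : ℝ | ∃ g : EuclideanSpace ℝ (Fin d) → ℝ, TestFun d g ∧
    v = ∫ x, ‖fderiv ℝ g x‖ ^ 2 + ρ / (1 - γ) * ∫ x, (mpow ((g x) ^ 2) γ - (g x) ^ 2)}

noncomputable def chiRWRS (d : ℕ) (H : ℝ → ℝ) (θ : ℝ) : ℝ :=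
  sInf {v : ℝ | ∃ g : EuclideanSpace ℝ (Fin d) → ℝ, TestFun d g ∧
    v = ∫ x, ‖fderiv ℝ g x‖ ^ 2 - θ * ∫ x, H ((g x) ^ 2)}

/-- `f` is regularly varying (at infinity) with index `idx`. -/
def RegVary (f : ℝ → ℝ) (idx : ℝ) : Prop :=
  ∀ y : ℝ, 0 < y → Tendsto (fun t => f (t * y) / f t) atTop (𝓝 (y ^ idx))

noncomputable def hatH (γ y : ℝ) : ℝ :=
  if γ = 1 then y * Real.log y else (y - mpow y γ) / (1 - γ)

/-- Assumption (H) of the paper. -/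
structure AssumptionH (H : ℝ → ℝ) (γ ρ : ℝ) (khat : ℝ → ℝ) : Prop where
  hγ : 0 ≤ γ
  hρ : 0 < ρ
  khat_pos : ∀ t, 0 < t → 0 < khat t
  khat_cont : ContinuousOn khat (Set.Ioi 0)
  khat_rv : RegVary khat γ
  conv : ∀ K : Set ℝ, IsCompact K → K ⊆ Set.Ici 0 →
    TendstoUniformlyOn (fun t y => (H (t * y) - y * H t) / khat t)
      (fun y => ρ * hatH γ y) atTop K

/-- The discrete Laplacian on `ℤ^d`. -/
noncomputable def discLap {d : ℕ} (f : Zd d → ℝ) (z : Zd d) : ℝ :=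
  ∑ i : Fin d,
    ((f (fun j => z j + if j = i then 1 else 0) - f z) +
     (f (fun j => z j - if j = i then 1 else 0) - f z))

/-- `u` is a nonnegative solution of the PAM equation with diffusion constant `κt`,
potential `ξ` and localised initial condition. -/
def IsSolPAM {d : ℕ} (κt : ℝ) (ξ : Zd d → ℝ) (u : ℝ → Zd d → ℝ) : Prop :=
  (∀ s z, 0 ≤ u s z) ∧
  (∀ z, u 0 z = if z = 0 then 1 else 0) ∧
  (∀ s, 0 < s → ∀ z,
    HasDerivAt (fun s' => u s' z) (κt * discLap (fun x => u s x) z + ξ z * u s z) s)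

/-- `u` is the minimal nonnegative solution. -/
def MinimalSol {d : ℕ} (κt : ℝ) (ξ : Zd d → ℝ) (u : ℝ → Zd d → ℝ) : Prop :=
  IsSolPAM κt ξ u ∧ ∀ v, IsSolPAM κt ξ v → ∀ s z, u s z ≤ v s z

/-- The half-open cube with corner `ε z` and side `ε`. -/
def latticeCube {d : ℕ} (ε : ℝ) (z : Zd d) : Set (EuclideanSpace ℝ (Fin d)) :=
  {x | ∀ i, ε * (z i : ℝ) ≤ x i ∧ x i < ε * (z i : ℝ) + ε}

/-- The index of the lattice cube of side `ε` containing a point. -/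
noncomputable def cubeIndex {d : ℕ} (ε : ℝ) (x : EuclideanSpace ℝ (Fin d)) : Zd d :=
  fun i => ⌊x i / ε⌋

lemma mem_latticeCube_iff {d : ℕ} {ε : ℝ} (hε : 0 < ε) (z : Zd d)
    (x : EuclideanSpace ℝ (Fin d)) : x ∈ latticeCube ε z ↔ cubeIndex ε x = z := by
  simp only [latticeCube, cubeIndex, Set.mem_ofPred_eq, funext_iff]
  refine forall_congr' fun i => ?_
  rw [Int.floor_eq_iff, le_div_iff₀ hε, div_lt_iff₀ hε, add_mul, one_mul, mul_comm]

lemma measurable_cubeIndex {d : ℕ} (ε : ℝ) :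
    Measurable (cubeIndex ε : EuclideanSpace ℝ (Fin d) → Zd d) := by
  unfold cubeIndex
  fun_prop

lemma volume_latticeCube {d : ℕ} {ε : ℝ} (hε : 0 < ε) (z : Zd d) :
    volume (latticeCube ε z) = ENNReal.ofReal (ε ^ d) := by
  have h : latticeCube ε z = (WithLp.ofLp : EuclideanSpace ℝ (Fin d) → Fin d → ℝ) ⁻¹'
      Set.pi Set.univ fun i => Set.Ico (ε * (z i : ℝ)) (ε * (z i : ℝ) + ε) := by
    ext x
    simp [latticeCube]
  rw [h, (PiLp.volume_preserving_ofLp (Fin d)).measure_preimage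
    (MeasurableSet.univ_pi fun _ => measurableSet_Ico).nullMeasurableSet, Real.volume_pi_Ico]
  simp [ENNReal.ofReal_pow hε.le]

lemma dist_le_of_mem_latticeCube {d : ℕ} {ε : ℝ} (hε : 0 < ε) {z : Zd d}
    {x y : EuclideanSpace ℝ (Fin d)} (hx : x ∈ latticeCube ε z) (hy : y ∈ latticeCube ε z) :
    dist x y ≤ √d * ε := by
  rw [EuclideanSpace.dist_eq]
  refine Real.sqrt_le_iff.2 ⟨by positivity, ?_⟩
  calc ∑ i, dist (x i) (y i) ^ 2 ≤ ∑ _i : Fin d, ε ^ 2 := by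
        refine Finset.sum_le_sum fun i _ => pow_le_pow_left₀ dist_nonneg ?_ 2
        rw [Real.dist_eq, abs_le]
        constructor <;> linarith [(hx i).1, (hx i).2, (hy i).1, (hy i).2]
    _ = (√d * ε) ^ 2 := by
        rw [mul_pow, Real.sq_sqrt (Nat.cast_nonneg d)]
        simp

/-- The average of `F` over the lattice cube of side `ε` containing `x`. -/
noncomputable def cubeAverage {d : ℕ} (F : EuclideanSpace ℝ (Fin d) → ℝ) (ε : ℝ)
    (x : EuclideanSpace ℝ (Fin d)) : ℝ :=
  (ε ^ d)⁻¹ * ∫ y in latticeCube ε (cubeIndex ε x), F y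

lemma abs_cubeAverage_sub_le {d : ℕ} {F : EuclideanSpace ℝ (Fin d) → ℝ} (hF : Integrable F)
    {ε : ℝ} (hε : 0 < ε) (x : EuclideanSpace ℝ (Fin d)) {c δ : ℝ}
    (h : ∀ y, dist y x ≤ √d * ε → |F y - c| ≤ δ) : |cubeAverage F ε x - c| ≤ δ := by
  set Q := latticeCube ε (cubeIndex ε x) with hQ
  have hx : x ∈ Q := (mem_latticeCube_iff hε _ x).2 rfl
  have hvol : volume Q = ENNReal.ofReal (ε ^ d) := volume_latticeCube hε _
  have hfin : volume Q < ⊤ := by simp [hvol]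
  have hreal : volume.real Q = ε ^ d := by
    rw [measureReal_def, hvol, ENNReal.toReal_ofReal (by positivity)]
  have hb : ‖∫ y in Q, (F y - c)‖ ≤ δ * volume.real Q :=
    norm_setIntegral_le_of_norm_le_const hfin fun y hy =>
      h y (dist_le_of_mem_latticeCube hε hy hx)
  rw [integral_sub hF.integrableOn (integrableOn_const hfin.ne), setIntegral_const, hreal,
    smul_eq_mul, Real.norm_eq_abs] at hb
  have hpos : 0 < ε ^ d := by positivity
  have heq : cubeAverage F ε x - c = (ε ^ d)⁻¹ * ((∫ y in Q, F y) - ε ^ d * c) := by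
    rw [cubeAverage, ← hQ]
    field_simp
  rw [heq, abs_mul, abs_of_pos (inv_pos.2 hpos), inv_mul_le_iff₀ hpos, mul_comm (ε ^ d) δ]
  exact hb

lemma tendsto_cubeAverage {d : ℕ} {F : EuclideanSpace ℝ (Fin d) → ℝ} (hF : Integrable F)
    (hFc : Continuous F) (x : EuclideanSpace ℝ (Fin d)) :
    Tendsto (fun ε => cubeAverage F ε x) (𝓝[>] 0) (𝓝 (F x)) := by
  rw [Metric.tendsto_nhds]
  intro δ hδ
  obtain ⟨η, hη, h⟩ := Metric.continuous_iff.1 hFc x (δ / 2) (half_pos hδ)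
  have hlim : Tendsto (fun ε : ℝ => √d * ε) (𝓝[>] 0) (𝓝 0) := by
    refine Tendsto.mono_left ?_ nhdsWithin_le_nhds
    simpa using (show Continuous fun ε : ℝ => √d * ε by fun_prop).tendsto 0
  filter_upwards [hlim.eventually_lt_const hη, self_mem_nhdsWithin] with ε hlt hε
  rw [Real.dist_eq]
  refine (abs_cubeAverage_sub_le hF hε x fun y hy => ?_).trans_lt (half_lt_self hδ)
  exact (h y (hy.trans_lt hlt)).le

lemma tendsto_integral_cubeAverage_rpow {d : ℕ} {F : EuclideanSpace ℝ (Fin d) → ℝ}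
    (hFc : Continuous F) (hFs : HasCompactSupport F) (hF0 : ∀ x, 0 ≤ F x) {γ : ℝ} (hγ : 0 < γ) :
    (∀ᶠ ε in 𝓝[>] (0 : ℝ), Integrable fun x => cubeAverage F ε x ^ γ) ∧
    Tendsto (fun ε => ∫ x, cubeAverage F ε x ^ γ) (𝓝[>] 0) (𝓝 (∫ x, F x ^ γ)) := by
  have hF : Integrable F := hFc.integrable_of_hasCompactSupport hFs
  obtain ⟨M, hM⟩ := hFc.bounded_above_of_compact_support hFs
  obtain ⟨R, hR⟩ := hFs.isCompact.isBounded.subset_closedBall 0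
  set B := Metric.closedBall (0 : EuclideanSpace ℝ (Fin d)) (R + √d)
  have hmeas : ∀ ε : ℝ, AEStronglyMeasurable (fun x => cubeAverage F ε x ^ γ) volume := by
    intro ε
    exact ((measurable_of_countable fun z : Zd d =>
      ((ε ^ d)⁻¹ * ∫ y in latticeCube ε z, F y) ^ γ).comp
      (measurable_cubeIndex ε)).aestronglyMeasurable
  have hnonneg : ∀ ε : ℝ, 0 < ε → ∀ x, 0 ≤ cubeAverage F ε x := by
    intro ε hε x
    exact mul_nonneg (by positivity) (integral_nonneg hF0)
  have hbound : ∀ ε : ℝ, 0 < ε → ε < 1 → ∀ x,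
      ‖cubeAverage F ε x ^ γ‖ ≤ B.indicator (fun _ => M ^ γ) x := by
    intro ε hε hε1 x
    have h0 := hnonneg ε hε x
    rw [Real.norm_of_nonneg (Real.rpow_nonneg h0 γ)]
    by_cases hx : x ∈ B
    · rw [Set.indicator_of_mem hx]
      refine Real.rpow_le_rpow h0 ?_ hγ.le
      have := abs_cubeAverage_sub_le hF hε x (c := 0) (δ := M) fun y _ => by simpa using hM y
      rw [sub_zero] at this
      exact (le_abs_self _).trans this
    · rw [Set.indicator_of_notMem hx]
      have := abs_cubeAverage_sub_le hF hε x (c := 0) (δ := 0) fun y hy => by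
        have hy' : y ∉ tsupport F := by
          intro hmem
          refine hx ?_
          have h1 : dist y 0 ≤ R := hR hmem
          have h2 : √d * ε ≤ √d := mul_le_of_le_one_right (Real.sqrt_nonneg _) hε1.le
          have h3 := dist_triangle_left x 0 y
          exact Metric.mem_closedBall.2 (by linarith)
        simp [image_eq_zero_of_notMem_tsupport hy']
      rw [sub_zero] at this
      rw [abs_nonpos_iff.1 this, Real.zero_rpow hγ.ne']
  have hint : Integrable (B.indicator fun _ => M ^ γ) :=
    (integrable_indicator_iff Metric.isClosed_closedBall.measurableSet).2
      (integrableOn_const (isCompact_closedBall _ _).measure_lt_top.ne)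
  have hev : ∀ᶠ ε in 𝓝[>] (0 : ℝ), 0 < ε ∧ ε < 1 := Ioo_mem_nhdsGT one_pos
  refine ⟨hev.mono fun ε h => hint.mono' (hmeas ε) (.of_forall (hbound ε h.1 h.2)), ?_⟩
  exact tendsto_integral_filter_of_dominated_convergence _ (.of_forall hmeas)
    (hev.mono fun ε h => .of_forall (hbound ε h.1 h.2)) hint
    (.of_forall fun x => (tendsto_cubeAverage hF hFc x).rpow_const (.inr hγ.le))

lemma integral_cubeAverage_rpow {d : ℕ} {F : EuclideanSpace ℝ (Fin d) → ℝ}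
    (hF0 : ∀ x, 0 ≤ F x) {γ ε : ℝ} (hε : 0 < ε)
    (hint : Integrable fun x => cubeAverage F ε x ^ γ) :
    ∫ x, cubeAverage F ε x ^ γ =
      ε ^ ((d : ℝ) * (1 - γ)) * ∑' z : Zd d, (∫ y in latticeCube ε z, F y) ^ γ := by
  set ψ : Zd d → ℝ := fun z => ((ε ^ d)⁻¹ * ∫ y in latticeCube ε z, F y) ^ γ
  have hm : Measurable (cubeIndex ε : EuclideanSpace ℝ (Fin d) → Zd d) := measurable_cubeIndex ε
  have hψ : Measurable ψ := measurable_of_countable ψ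
  have hψi : Integrable ψ (volume.map (cubeIndex ε)) :=
    (integrable_map_measure hψ.aestronglyMeasurable hm.aemeasurable).2 hint
  have h1 : ∫ x, cubeAverage F ε x ^ γ = ∫ z, ψ z ∂(volume.map (cubeIndex ε)) :=
    (integral_map hm.aemeasurable hψ.aestronglyMeasurable).symm
  rw [h1, integral_countable hψi, ← tsum_mul_left]
  refine tsum_congr fun z => ?_
  have hpre : cubeIndex ε ⁻¹' {z} = latticeCube ε z := by
    ext x
    exact (mem_latticeCube_iff hε z x).symm
  rw [measureReal_def, Measure.map_apply hm (measurableSet_singleton z), hpre,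
    volume_latticeCube hε, ENNReal.toReal_ofReal (by positivity), smul_eq_mul]
  simp only [ψ]
  rw [Real.mul_rpow (by positivity) (integral_nonneg hF0), ← mul_assoc]
  congr 1
  rw [← Real.rpow_natCast, ← Real.rpow_neg hε.le, ← Real.rpow_mul hε.le, ← Real.rpow_add hε]
  ring_nf

/-- **Statement 14.** For the discretisation `p_ε` of a smooth compactly supported
`L²`-normalised `g ≥ 0` and `γ > 0`, one has
`ε^{d(1−γ)}·Σ_z p_ε(z)^γ → ∫ g^{2γ}` as `ε ↓ 0`. -/
theorem stmt15 (d : ℕ) (hd : 1 ≤ d) (γ : ℝ) (hγ : 0 < γ) (g : EuclideanSpace ℝ (Fin d) → ℝ)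
    (hg : ContDiff ℝ (⊤ : ℕ∞) g) (hgc : HasCompactSupport g) (hg0 : ∀ x, 0 ≤ g x)
    (hgnorm : ∫ x, (g x) ^ 2 = 1)
    (p : ℝ → Zd d → ℝ)
    (hp : ∀ ε, 0 < ε → ∀ z : Zd d, p ε z =
      ∫ x in {x : EuclideanSpace ℝ (Fin d) |
        ∀ i, ε * (z i : ℝ) ≤ x i ∧ x i < ε * (z i : ℝ) + ε}, (g x) ^ 2) :
    Tendsto (fun ε => ε ^ ((d : ℝ) * (1 - γ)) * ∑' z : Zd d, p ε z ^ γ) (𝓝[>] 0)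
      (𝓝 (∫ x, g x ^ (2 * γ))) := by
  have hFc : Continuous fun x => g x ^ 2 := hg.continuous.pow 2
  have hFs : HasCompactSupport fun x => g x ^ 2 :=
    hgc.comp_left (g := fun t : ℝ => t ^ 2) (by simp)
  have hF0 : ∀ x, 0 ≤ g x ^ 2 := fun x => sq_nonneg _
  obtain ⟨hint, hlim⟩ := tendsto_integral_cubeAverage_rpow hFc hFs hF0 hγ
  have hlimit : ∫ x, g x ^ (2 * γ) = ∫ x, (g x ^ 2) ^ γ := by
    refine integral_congr_ae (.of_forall fun x => ?_)
    simp only [Real.rpow_mul (hg0 x), Real.rpow_two]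
  rw [hlimit]
  refine hlim.congr' ?_
  filter_upwards [hint, self_mem_nhdsWithin] with ε hi hε
  rw [integral_cubeAverage_rpow hF0 hε hi]
  simp only [hp ε hε, latticeCube]
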